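/- Suppose r is a positive integer with gcd(r, 6) = 1, N is a positive integer, χ is a Dirichlet character modulo N, and p ≥ 5 is prime. Then the operator V_p maps M_k(N, χν_η^r) into M_k(Np, χχ_p ν_η^{pr}), where χ_p = (•/p) is the quadratic character modulo p. -/

import Mathlib

open Complex UpperHalfPlane CongruenceSubgroup Matrix NumberField
open scoped Manifold MatrixGroups Real

noncomputable section

abbrev SL2Z := Matrix.SpecialLinearGroup (Fin 2) ℤ

/-- The automorphy denominator `c z + d` for `γ = (a b; c d)`. -/
def sldenom (γ : SL2Z) (z : ℍ) : ℂ := ((γ 1 0 : ℤ) : ℂ) * (z : ℂ) + ((γ 1 1 : ℤ) : ℂ)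

/-- `q^{n/24} = e^{2π i n z/24}`. -/
def q24 (n : ℕ) (z : ℍ) : ℂ := Complex.exp (2 * Real.pi * Complex.I * (n : ℂ) * (z : ℂ) / 24)

/-- The Dedekind eta function `η(z) = q^{1/24} ∏_{n≥1} (1 - qⁿ)`. -/
def dedekindEta (z : ℍ) : ℂ :=
  Complex.exp (Real.pi * Complex.I * (z : ℂ) / 12) *
    ∏' n : ℕ, (1 - Complex.exp (2 * Real.pi * Complex.I * ((n : ℂ) + 1) * (z : ℂ)))

/-- The Jacobi theta function `θ(z) = Σ_{n ∈ ℤ} q^{n²}`. -/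
def theta (z : ℍ) : ℂ := ∑' n : ℤ, Complex.exp (2 * Real.pi * Complex.I * ((n : ℂ)) ^ 2 * (z : ℂ))

/-- The eta multiplier `ν_η`, characterized by
`η(γz) = ν_η(γ) (cz+d)^{1/2} η(z)` (principal branch); we evaluate at `z = i`. -/
def nuEta (γ : SL2Z) : ℂ :=
  dedekindEta (γ • UpperHalfPlane.I) / (sldenom γ UpperHalfPlane.I ^ ((1 : ℂ) / 2) * dedekindEta UpperHalfPlane.I)

/-- The theta multiplier `ν_θ`, characterized by
`θ(γz) = ν_θ(γ) (cz+d)^{1/2} θ(z)` (principal branch) for `γ ∈ Γ₀(4)`. -/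
def nuTheta (γ : SL2Z) : ℂ :=
  theta (γ • UpperHalfPlane.I) /
    (sldenom γ UpperHalfPlane.I ^ ((1 : ℂ) / 2) * theta UpperHalfPlane.I)

/-- The Kronecker symbol `(12/n)`. -/
def kron12 (n : ℤ) : ℤ :=
  if n % 12 = 1 ∨ n % 12 = 11 then 1 else if n % 12 = 5 ∨ n % 12 = 7 then -1 else 0

/-- Holomorphic modular forms of (possibly half-integral) weight `k`, level `Γ₀(N)` and
multiplier system `ν`: holomorphy, transformation, and boundedness at all cusps. -/
def IsModForm (N : ℕ) (k : ℝ) (ν : SL2Z → ℂ) (f : ℍ → ℂ) : Prop :=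
  MDifferentiable 𝓘(ℂ) 𝓘(ℂ) f ∧
  (∀ γ ∈ Gamma0 N, ∀ z : ℍ, f (γ • z) = ν γ * sldenom γ z ^ (k : ℂ) * f z) ∧
  ∀ γ : SL2Z, IsBoundedAtImInfty fun z => sldenom γ z ^ (-(k : ℂ)) * f (γ • z)

/-- Cusp forms of (possibly half-integral) weight `k`, level `Γ₀(N)` and multiplier `ν`. -/
def IsCuspForm (N : ℕ) (k : ℝ) (ν : SL2Z → ℂ) (f : ℍ → ℂ) : Prop :=
  MDifferentiable 𝓘(ℂ) 𝓘(ℂ) f ∧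
  (∀ γ ∈ Gamma0 N, ∀ z : ℍ, f (γ • z) = ν γ * sldenom γ z ^ (k : ℂ) * f z) ∧
  ∀ γ : SL2Z, IsZeroAtImInfty fun z => sldenom γ z ^ (-(k : ℂ)) * f (γ • z)

/-- Weakly holomorphic modular forms: meromorphic at the cusps. -/
def IsWeakModForm (N : ℕ) (k : ℝ) (ν : SL2Z → ℂ) (f : ℍ → ℂ) : Prop :=
  MDifferentiable 𝓘(ℂ) 𝓘(ℂ) f ∧
  (∀ γ ∈ Gamma0 N, ∀ z : ℍ, f (γ • z) = ν γ * sldenom γ z ^ (k : ℂ) * f z) ∧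
  ∀ γ : SL2Z, ∃ m : ℕ, IsBoundedAtImInfty fun z =>
    q24 m z * (sldenom γ z ^ (-(k : ℂ)) * f (γ • z))

/-- `x ∈ K` is `v`-integral: it is a quotient `a/b` with `a, b ∈ 𝓞 K`, `b ∉ v`. -/
def VInt {K : Type*} [Field K] [NumberField K] (v : Ideal (𝓞 K)) (x : K) : Prop :=
  ∃ a b : 𝓞 K, b ∉ v ∧ (b : K) * x = (a : K)

/-- Congruence modulo `v` in the ring of `v`-integral elements of `K`. -/
def VCong {K : Type*} [Field K] [NumberField K] (v : Ideal (𝓞 K)) (x y : K) : Prop :=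
  ∃ a b : 𝓞 K, b ∉ v ∧ a ∈ v ∧ (b : K) * (x - y) = (a : K)

/-- The point `24 z` of the upper half-plane. -/
def smul24 (z : ℍ) : ℍ := ⟨24 * (z : ℂ), by
  have := z.2
  simp only [Complex.mul_im]
  norm_num
  simpa using this⟩

/-- Horizontal translation `z ↦ z + x` on the upper half-plane. -/
def hshift (x : ℝ) (z : ℍ) : ℍ := ⟨(z : ℂ) + (x : ℂ), by simpa using z.2⟩

/-- `ε_p`: `1` if `p ≡ 1 (mod 4)`, `i` if `p ≡ 3 (mod 4)`. -/
def epsP (p : ℕ) : ℂ := if p % 4 = 1 then 1 else Complex.I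


lemma dedekindEta_eq (z : ℍ) : dedekindEta z = ModularForm.eta z := by
  simp only [dedekindEta, ModularForm.eta, ModularForm.eta_q_eq_cexp]
  rw [Function.Periodic.qParam]
  congr 2
  push_cast
  ring

lemma dedekindEta_ne_zero (z : ℍ) : dedekindEta z ≠ 0 := by
  rw [dedekindEta_eq]
  exact ModularForm.eta_ne_zero z.2

lemma continuous_dedekindEta : Continuous dedekindEta := by
  have h : dedekindEta = fun z : ℍ => ModularForm.eta z := funext dedekindEta_eq
  rw [h, continuous_iff_continuousAt]
  intro z
  exact ContinuousAt.comp
    (ModularForm.differentiableAt_eta_of_mem_upperHalfPlaneSet z.2).continuousAt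
    UpperHalfPlane.continuous_coe.continuousAt

lemma sldenom_eq_denom (γ : SL2Z) (z : ℍ) : sldenom γ z = UpperHalfPlane.denom γ z := by
  simp [UpperHalfPlane.denom, sldenom]

lemma sldenom_ne_zero (γ : SL2Z) (z : ℍ) : sldenom γ z ≠ 0 := by
  rw [sldenom_eq_denom]
  exact UpperHalfPlane.denom_ne_zero _ z

lemma coe_smul_eq_div (γ : SL2Z) (z : ℍ) :
    ((γ • z : ℍ) : ℂ) = ((γ 0 0 : ℤ) * (z : ℂ) + (γ 0 1 : ℤ)) / sldenom γ z := by
  rw [UpperHalfPlane.coe_specialLinearGroup_apply, sldenom]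
  simp

lemma sldenom_mul (γ δ : SL2Z) (z : ℍ) :
    sldenom (γ * δ) z = sldenom γ (δ • z) * sldenom δ z := by
  rw [sldenom, sldenom, coe_smul_eq_div, add_mul, mul_assoc,
    div_mul_cancel₀ _ (sldenom_ne_zero δ z)]
  simp [sldenom, Matrix.mul_apply, Fin.sum_univ_two]
  ring

lemma continuous_sldenom (γ : SL2Z) : Continuous (sldenom γ) := by
  unfold sldenom
  fun_prop

lemma dedekindEta_smul_pow (γ : SL2Z) (z : ℍ) :
    dedekindEta (γ • z) ^ 24 = sldenom γ z ^ 12 * dedekindEta z ^ 24 := by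
  have h := congrFun (SlashInvariantForm.slash_action_generators_SL2Z
    ModularForm.discriminant_S_invariant ModularForm.discriminant_T_invariant γ) z
  rw [ModularForm.SL_slash_apply, ← sldenom_eq_denom, ModularForm.discriminant,
    ModularForm.discriminant, ← dedekindEta_eq, ← dedekindEta_eq] at h
  rw [← h, _root_.zpow_neg]
  have := sldenom_ne_zero γ z
  field_simp

lemma sldenom_im (γ : SL2Z) (z : ℍ) : (sldenom γ z).im = γ 1 0 * z.im := by
  simp [sldenom]

lemma continuous_sldenom_cpow (γ : SL2Z) (s : ℂ) : Continuous fun z => sldenom γ z ^ s := by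
  by_cases hc : γ 1 0 = 0
  · have : (fun z => sldenom γ z ^ s) = fun _ => ((γ 1 1 : ℤ) : ℂ) ^ s := by
      ext z; simp [sldenom, hc]
    rw [this]
    exact continuous_const
  · refine (continuous_sldenom γ).cpow continuous_const fun z => Or.inr ?_
    rw [sldenom_im]
    exact mul_ne_zero (by exact_mod_cast hc) z.im_pos.ne'

/-- A continuous function on the upper half-plane with values in the `n`-th roots of unity is
constant. -/
lemma eq_of_continuous_of_pow_eq_one {n : ℕ} (hn : 0 < n) {g : ℍ → ℂ} (hg : Continuous g)
    (h : ∀ z, g z ^ n = 1) (z w : ℍ) : g z = g w := by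
  have hfin : ({x : ℂ | x ^ n = 1}).Finite := by
    refine (Polynomial.nthRoots n (1 : ℂ)).toFinset.finite_toSet.subset fun x hx => ?_
    simpa [Polynomial.mem_nthRoots hn] using hx
  exact isPreconnected_univ.constant_of_mapsTo (T := {x : ℂ | x ^ n = 1}) hfin.isDiscrete
    hg.continuousOn (fun x _ => h x) (Set.mem_univ z) (Set.mem_univ w)

lemma cpow_half_sq (x : ℂ) : (x ^ ((1 : ℂ) / 2)) ^ 2 = x := by
  simp [← Complex.cpow_nat_mul]

lemma cpow_half_ne_zero {x : ℂ} (hx : x ≠ 0) : x ^ ((1 : ℂ) / 2) ≠ 0 := by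
  simp [Complex.cpow_eq_zero_iff, hx]

/-- The transformation law of the Dedekind eta function. -/
lemma dedekindEta_smul (γ : SL2Z) (z : ℍ) :
    dedekindEta (γ • z) = nuEta γ * sldenom γ z ^ ((1 : ℂ) / 2) * dedekindEta z := by
  have hne : ∀ w, sldenom γ w ^ ((1 : ℂ) / 2) * dedekindEta w ≠ 0 := fun w =>
    mul_ne_zero (cpow_half_ne_zero (sldenom_ne_zero γ w)) (dedekindEta_ne_zero w)
  have hg : Continuous fun w : ℍ =>
      dedekindEta (γ • w) / (sldenom γ w ^ ((1 : ℂ) / 2) * dedekindEta w) :=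
    (continuous_dedekindEta.comp (continuous_const_smul (γ : GL (Fin 2) ℝ))).div
      ((continuous_sldenom_cpow γ _).mul continuous_dedekindEta) hne
  have h := eq_of_continuous_of_pow_eq_one (n := 24) (by norm_num) hg (fun w => by
    rw [div_pow, dedekindEta_smul_pow, mul_pow,
      show (sldenom γ w ^ ((1 : ℂ) / 2)) ^ 24 = sldenom γ w ^ 12 by
        rw [pow_mul _ 2 12, cpow_half_sq]]
    exact div_self (mul_ne_zero (pow_ne_zero _ (sldenom_ne_zero γ w))
      (pow_ne_zero _ (dedekindEta_ne_zero w)))) z UpperHalfPlane.I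
  rw [mul_assoc, nuEta, ← h, div_mul_cancel₀ _ (hne z)]

lemma nuEta_ne_zero (γ : SL2Z) : nuEta γ ≠ 0 :=
  div_ne_zero (dedekindEta_ne_zero _)
    (mul_ne_zero (cpow_half_ne_zero (sldenom_ne_zero γ _)) (dedekindEta_ne_zero _))

lemma nuEta_eq_of_smul {γ : SL2Z} {z : ℍ} {w : ℂ}
    (h : dedekindEta (γ • z) = w * sldenom γ z ^ ((1 : ℂ) / 2) * dedekindEta z) :
    nuEta γ = w := by
  rw [dedekindEta_smul] at h
  exact mul_right_cancel₀ (cpow_half_ne_zero (sldenom_ne_zero γ z))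
    (mul_right_cancel₀ (dedekindEta_ne_zero z) h)

lemma mul_cpow_of_arg {x y : ℂ} (hx : x ≠ 0) (hy : y ≠ 0) (h : x.arg + y.arg ∈ Set.Ioc (-π) π)
    (s : ℂ) : (x * y) ^ s = x ^ s * y ^ s := by
  rw [Complex.cpow_def_of_ne_zero hx, Complex.cpow_def_of_ne_zero hy,
    Complex.cpow_def_of_ne_zero (mul_ne_zero hx hy), (Complex.log_mul_eq_add_log_iff hx hy).2 h,
    add_mul, Complex.exp_add]

lemma nuEta_mul_of_arg {γ δ : SL2Z} {z : ℍ}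
    (h : (sldenom γ (δ • z)).arg + (sldenom δ z).arg ∈ Set.Ioc (-π) π) :
    nuEta (γ * δ) = nuEta γ * nuEta δ := by
  apply nuEta_eq_of_smul (z := z)
  rw [mul_smul, dedekindEta_smul, dedekindEta_smul, sldenom_mul,
    mul_cpow_of_arg (sldenom_ne_zero _ _) (sldenom_ne_zero _ _) h]
  ring

/-- `e^{2πin/24}`. -/
def e24 (n : ℤ) : ℂ := Complex.exp (2 * π * Complex.I * n / 24)

lemma e24_add (m n : ℤ) : e24 (m + n) = e24 m * e24 n := by
  rw [e24, e24, e24, ← Complex.exp_add]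
  congr 1
  push_cast
  ring

lemma e24_pow (m : ℤ) (n : ℕ) : e24 m ^ n = e24 (n * m) := by
  rw [e24, e24, ← Complex.exp_nat_mul]
  congr 1
  push_cast
  ring

lemma e24_twelve_mul (n : ℕ) : e24 (12 * n) = (-1) ^ n := by
  rw [mul_comm, ← e24_pow, e24, show 2 * (π : ℂ) * Complex.I * (12 : ℤ) / 24 = π * Complex.I by
    push_cast; ring, Complex.exp_pi_mul_I]

lemma e24_eq_of_dvd {m n : ℤ} (h : 24 ∣ m - n) : e24 m = e24 n := by
  obtain ⟨k, hk⟩ := h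
  rw [show m = n + 24 * k by linarith, e24_add]
  have : e24 (24 * k) = 1 := by
    rw [e24, Complex.exp_eq_one_iff]
    exact ⟨k, by push_cast; ring⟩
  rw [this, mul_one]

lemma dedekindEta_vadd (n : ℤ) (z : ℍ) :
    dedekindEta (ModularGroup.T ^ n • z) = e24 n * dedekindEta z := by
  have hz : ((ModularGroup.T ^ n • z : ℍ) : ℂ) = z + n := by
    rw [UpperHalfPlane.modular_T_zpow_smul]
    simp [add_comm]
  rw [dedekindEta, dedekindEta, hz, e24, ← mul_assoc, ← Complex.exp_add]
  congr 1
  · congr 1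
    ring
  · refine tprod_congr fun m => ?_
    rw [show 2 * (π : ℂ) * Complex.I * ((m : ℂ) + 1) * ((z : ℂ) + n) =
      2 * π * Complex.I * ((m : ℂ) + 1) * z + ((m + 1) * n : ℤ) * (2 * π * Complex.I) by
        push_cast; ring, Complex.exp_periodic.int_mul]

lemma sldenom_T_zpow (n : ℤ) (z : ℍ) : sldenom (ModularGroup.T ^ n) z = 1 := by
  simp [sldenom, ModularGroup.coe_T_zpow]

lemma nuEta_mul_T_zpow (γ : SL2Z) (n : ℤ) :
    nuEta (γ * ModularGroup.T ^ n) = nuEta γ * e24 n := by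
  apply nuEta_eq_of_smul (z := UpperHalfPlane.I)
  rw [mul_smul, dedekindEta_smul, dedekindEta_vadd, sldenom_mul, sldenom_T_zpow, mul_one]
  ring

lemma nuEta_T_zpow_mul (γ : SL2Z) (n : ℤ) :
    nuEta (ModularGroup.T ^ n * γ) = e24 n * nuEta γ := by
  apply nuEta_eq_of_smul (z := UpperHalfPlane.I)
  rw [mul_smul, dedekindEta_vadd, dedekindEta_smul, sldenom_mul, sldenom_T_zpow, one_mul]
  ring

lemma S_smul_I : ModularGroup.S • UpperHalfPlane.I = UpperHalfPlane.I := by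
  ext
  rw [coe_smul_eq_div]
  simp [sldenom, ModularGroup.S]

lemma S_inv_smul_I : ModularGroup.S⁻¹ • UpperHalfPlane.I = UpperHalfPlane.I := by
  rw [inv_smul_eq_iff, S_smul_I]

lemma sldenom_S_I : sldenom ModularGroup.S UpperHalfPlane.I = Complex.I := by
  simp [sldenom, ModularGroup.S]

lemma mul_apply_eq (γ δ : SL2Z) (i j : Fin 2) :
    (γ * δ) i j = γ i 0 * δ 0 j + γ i 1 * δ 1 j := by
  rw [Matrix.SpecialLinearGroup.coe_mul, Matrix.mul_apply, Fin.sum_univ_two]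

lemma sldenom_S_inv_I : sldenom ModularGroup.S⁻¹ UpperHalfPlane.I = -Complex.I := by
  simp [sldenom]

lemma nuEta_S : nuEta ModularGroup.S = e24 (-3) := by
  apply nuEta_eq_of_smul (z := UpperHalfPlane.I)
  rw [S_smul_I, sldenom_S_I, Complex.cpow_def_of_ne_zero Complex.I_ne_zero, Complex.log_I, e24,
    ← Complex.exp_add]
  ring_nf
  simp

lemma nuEta_S_inv : nuEta ModularGroup.S⁻¹ = e24 3 := by
  apply nuEta_eq_of_smul (z := UpperHalfPlane.I)
  rw [S_inv_smul_I, sldenom_S_inv_I, Complex.cpow_def_of_ne_zero (neg_ne_zero.2 Complex.I_ne_zero),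
    Complex.log_neg_I, e24, ← Complex.exp_add]
  ring_nf
  simp

lemma nuEta_mul_S {γ : SL2Z} (hc : 0 < γ 1 0) (hd : 0 < γ 1 1) :
    nuEta (γ * ModularGroup.S) = nuEta γ * e24 (-3) := by
  rw [nuEta_mul_of_arg (z := UpperHalfPlane.I), nuEta_S]
  rw [S_smul_I, sldenom_S_I, Complex.arg_I]
  have h1 : 0 ≤ (sldenom γ UpperHalfPlane.I).arg := by
    rw [Complex.arg_nonneg_iff]
    simp [sldenom, hc.le]
  have h2 : |(sldenom γ UpperHalfPlane.I).arg| ≤ π / 2 := by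
    rw [Complex.abs_arg_le_pi_div_two_iff]
    simp [sldenom, hd.le]
  constructor <;> linarith [Real.pi_pos, abs_le.1 h2]

lemma nuEta_mul_S_inv {γ : SL2Z} (hc : 0 < γ 1 0) :
    nuEta (γ * ModularGroup.S⁻¹) = nuEta γ * e24 3 := by
  rw [nuEta_mul_of_arg (z := UpperHalfPlane.I), nuEta_S_inv]
  rw [S_inv_smul_I, sldenom_S_inv_I, Complex.arg_neg_I]
  have h1 : 0 ≤ (sldenom γ UpperHalfPlane.I).arg := by
    rw [Complex.arg_nonneg_iff]
    simp [sldenom, hc.le]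
  have h2 := Complex.arg_le_pi (sldenom γ UpperHalfPlane.I)
  constructor <;> linarith [Real.pi_pos]

/-- The exponent in the explicit formula for `nuEta γ` when `γ 1 0` is odd. -/
def etaExponent (γ : SL2Z) : ℤ :=
  (γ 0 0 + γ 1 1) * γ 1 0 - γ 0 1 * γ 1 1 * (γ 1 0 ^ 2 - 1) - 3 * γ 1 0

/-- The explicit value of `nuEta γ` when `γ 1 0` is odd and positive. -/
def etaMultiplier (γ : SL2Z) : ℂ :=
  (jacobiSym (γ 1 1) (γ 1 0).natAbs : ℂ) * e24 (etaExponent γ)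

lemma det_eq_one (γ : SL2Z) : γ 0 0 * γ 1 1 - γ 0 1 * γ 1 0 = 1 := by
  have := γ.2
  rwa [Matrix.det_fin_two] at this

lemma dvd_mul_sq_sub_one {c : ℤ} (hc : Odd c) : 24 ∣ c * (c ^ 2 - 1) := by
  have h8 : (8 : ℤ) ∣ c ^ 2 - 1 := Int.eight_dvd_sq_sub_one_of_odd hc
  have h3 : (3 : ℤ) ∣ c * (c ^ 2 - 1) := by
    have : c % 3 = 0 ∨ c % 3 = 1 ∨ c % 3 = 2 := by omega
    apply Int.dvd_of_emod_eq_zero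
    rcases this with h | h | h <;> simp [Int.mul_emod, Int.sub_emod, pow_two, h]
  have := IsCoprime.mul_dvd (by norm_num : IsCoprime (8 : ℤ) 3) (h8.mul_left c) h3
  simpa using this

lemma etaMultiplier_mul_T_zpow {γ : SL2Z} (hc : Odd (γ 1 0)) (n : ℤ) :
    etaMultiplier (γ * ModularGroup.T ^ n) = etaMultiplier γ * e24 n := by
  have hdet := det_eq_one γ
  have h00 : (γ * ModularGroup.T ^ n) 0 0 = γ 0 0 := by
    simp [mul_apply_eq, ModularGroup.coe_T_zpow]
  have h01 : (γ * ModularGroup.T ^ n) 0 1 = γ 0 0 * n + γ 0 1 := by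
    simp [mul_apply_eq, ModularGroup.coe_T_zpow]
  have h10 : (γ * ModularGroup.T ^ n) 1 0 = γ 1 0 := by
    simp [mul_apply_eq, ModularGroup.coe_T_zpow]
  have h11 : (γ * ModularGroup.T ^ n) 1 1 = γ 1 0 * n + γ 1 1 := by
    simp [mul_apply_eq, ModularGroup.coe_T_zpow]
  rw [etaMultiplier, etaMultiplier, mul_assoc, ← e24_add, etaExponent, etaExponent, h00, h01, h10,
    h11]
  congr 1
  · congr 1
    apply jacobiSym.mod_left'
    rw [Int.emod_eq_emod_iff_emod_sub_eq_zero, add_sub_cancel_right]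
    apply Int.emod_eq_zero_of_dvd
    rw [Int.natCast_natAbs, abs_dvd]
    exact dvd_mul_right _ _
  · apply e24_eq_of_dvd
    convert! (dvd_mul_sq_sub_one hc).mul_right (-(γ 0 0 * n ^ 2) - 2 * γ 0 1 * n) using 1
    linear_combination -n * (γ 1 0 ^ 2 - 1) * hdet

lemma jacobiSym_eq_neg_one_pow {c d : ℕ} (hc : Odd c) (hd : Odd d) :
    jacobiSym d c = (-1) ^ ((c / 2 + 1) * (d / 2)) * jacobiSym (-c) d := by
  rw [jacobiSym.quadratic_reciprocity hd hc, jacobiSym.neg _ hd,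
    ZMod.χ₄_eq_neg_one_pow (Nat.odd_iff.1 hd), ← mul_assoc, ← pow_add]
  congr 1
  rw [show (c / 2 + 1) * (d / 2) + d / 2 = d / 2 * (c / 2) + 2 * (d / 2) by ring, pow_add,
    pow_mul _ 2]
  simp

lemma jacobiSym_neg_eq_neg_one_pow {c d : ℕ} (hc : Odd c) (hd : Odd d) :
    jacobiSym (-d) c = (-1) ^ (c / 2 * (d / 2 + 1)) * jacobiSym c d := by
  rw [jacobiSym.neg _ hc, jacobiSym.quadratic_reciprocity hd hc,
    ZMod.χ₄_eq_neg_one_pow (Nat.odd_iff.1 hc), ← mul_assoc, ← pow_add]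
  ring_nf

lemma etaMultiplier_mul_S {γ : SL2Z} {c d : ℕ} (hc : γ 1 0 = c) (hd : γ 1 1 = d)
    (hc2 : Odd c) (hd2 : Odd d) :
    etaMultiplier (γ * ModularGroup.S) = etaMultiplier γ * e24 (-3) := by
  have hdet := det_eq_one γ
  have h00 : (γ * ModularGroup.S) 0 0 = γ 0 1 := by
    simp [mul_apply_eq, ModularGroup.coe_S]
  have h01 : (γ * ModularGroup.S) 0 1 = -γ 0 0 := by
    simp [mul_apply_eq, ModularGroup.coe_S]
  have h10 : (γ * ModularGroup.S) 1 0 = d := by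
    simp [mul_apply_eq, ModularGroup.coe_S, hd]
  have h11 : (γ * ModularGroup.S) 1 1 = -c := by
    simp [mul_apply_eq, ModularGroup.coe_S, hc]
  rw [etaMultiplier, etaMultiplier, etaExponent, etaExponent, h00, h01, h10, h11]
  rw [hc, hd] at hdet ⊢
  rw [Int.natAbs_natCast, Int.natAbs_natCast, jacobiSym_eq_neg_one_pow hc2 hd2]
  push_cast
  have key : e24 ((γ 0 1 + -(c : ℤ)) * d - -γ 0 0 * -c * (d ^ 2 - 1) - 3 * d) =
      e24 (12 * ((c / 2 + 1) * (d / 2) : ℕ)) *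
        e24 ((γ 0 0 + d) * c - γ 0 1 * d * (c ^ 2 - 1) - 3 * c) * e24 (-3) := by
    rw [← e24_add, ← e24_add]
    apply e24_eq_of_dvd
    obtain ⟨u, rfl⟩ := hc2
    obtain ⟨v, rfl⟩ := hd2
    rw [show (2 * u + 1) / 2 = u by omega, show (2 * v + 1) / 2 = v by omega]
    push_cast at hdet ⊢
    refine ⟨-(u + 1) * v, ?_⟩
    linear_combination (-1) * (2 * (u : ℤ) + 1) * (2 * v + 1) * hdet
  rw [key, e24_twelve_mul]
  ring

lemma etaMultiplier_mul_S_inv {γ : SL2Z} {c d : ℕ} (hc : γ 1 0 = c) (hd : γ 1 1 = -d)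
    (hc2 : Odd c) (hd2 : Odd d) :
    etaMultiplier (γ * ModularGroup.S⁻¹) = etaMultiplier γ * e24 3 := by
  have hdet := det_eq_one γ
  have h00 : (γ * ModularGroup.S⁻¹) 0 0 = -γ 0 1 := by
    simp [mul_apply_eq]
  have h01 : (γ * ModularGroup.S⁻¹) 0 1 = γ 0 0 := by
    simp [mul_apply_eq]
  have h10 : (γ * ModularGroup.S⁻¹) 1 0 = d := by
    simp [mul_apply_eq, hd]
  have h11 : (γ * ModularGroup.S⁻¹) 1 1 = c := by
    simp [mul_apply_eq, hc]
  rw [etaMultiplier, etaMultiplier, etaExponent, etaExponent, h00, h01, h10, h11]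
  rw [hc, hd] at hdet ⊢
  rw [Int.natAbs_natCast, Int.natAbs_natCast, jacobiSym_neg_eq_neg_one_pow hc2 hd2]
  push_cast
  have key : e24 ((-γ 0 1 + (c : ℤ)) * d - γ 0 0 * c * (d ^ 2 - 1) - 3 * d) =
      e24 (12 * (c / 2 * (d / 2 + 1) : ℕ)) *
        e24 ((γ 0 0 + -(d : ℤ)) * c - γ 0 1 * -(d : ℤ) * (c ^ 2 - 1) - 3 * c) * e24 3 := by
    rw [← e24_add, ← e24_add]
    apply e24_eq_of_dvd
    obtain ⟨u, rfl⟩ := hc2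
    obtain ⟨v, rfl⟩ := hd2
    rw [show (2 * u + 1) / 2 = u by omega, show (2 * v + 1) / 2 = v by omega]
    push_cast at hdet ⊢
    refine ⟨0, ?_⟩
    linear_combination (2 * (u : ℤ) + 1) * (2 * v + 1) * hdet
  rw [key, e24_twelve_mul]
  ring

lemma exists_odd_natAbs_lt {c : ℕ} (hc : Odd c) (hc1 : 1 < c) {d : ℤ}
    (hd : ¬ (c : ℤ) ∣ d) : ∃ n : ℤ, Odd (c * n + d) ∧ (c * n + d).natAbs < c := by
  have h0 := Int.emod_nonneg d (by omega : (c : ℤ) ≠ 0)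
  have h1 := Int.emod_lt_of_pos d (by omega : (0 : ℤ) < c)
  have h2 := Int.emod_add_mul_ediv d c
  obtain ⟨u, hu⟩ := hc
  rcases Int.even_or_odd (d % c) with he | ho
  · refine ⟨-(d / c) - 1, ?_⟩
    have h : (c : ℤ) * (-(d / c) - 1) + d = d % c - c := by linear_combination -h2
    obtain ⟨v, hv⟩ := he
    rw [h]
    refine ⟨⟨v - u - 1, by omega⟩, ?_⟩
    have : d % c ≠ 0 := fun h => hd (Int.dvd_of_emod_eq_zero h)
    omega
  · refine ⟨-(d / c), ?_⟩
    have h : (c : ℤ) * (-(d / c)) + d = d % c := by linear_combination -h2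
    rw [h]
    exact ⟨ho, by omega⟩

lemma e24_ne_zero (n : ℤ) : e24 n ≠ 0 := Complex.exp_ne_zero _

/-- For odd positive lower-left entry, `ν_η` is given by the classical explicit formula. -/
lemma nuEta_eq_etaMultiplier {c : ℕ} (hc : Odd c) (γ : SL2Z) (h : γ 1 0 = c) :
    nuEta γ = etaMultiplier γ := by
  induction c using Nat.strong_induction_on generalizing γ with
  | _ c ih =>
  have hT10 (n : ℤ) : (γ * ModularGroup.T ^ n) 1 0 = c := by
    simp [mul_apply_eq, ModularGroup.coe_T_zpow, h]
  have hT11 (n : ℤ) : (γ * ModularGroup.T ^ n) 1 1 = c * n + γ 1 1 := by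
    simp [mul_apply_eq, ModularGroup.coe_T_zpow, h]
  have hcz : Odd (γ 1 0) := by rw [h]; exact_mod_cast hc
  suffices H : ∃ n : ℤ, nuEta (γ * ModularGroup.T ^ n) = etaMultiplier (γ * ModularGroup.T ^ n) by
    obtain ⟨n, hn⟩ := H
    rw [nuEta_mul_T_zpow, etaMultiplier_mul_T_zpow hcz] at hn
    exact mul_right_cancel₀ (e24_ne_zero n) hn
  have hdet := det_eq_one γ
  obtain rfl | hc1 : c = 1 ∨ 1 < c := by have := hc.pos; omega
  · refine ⟨-γ 1 1, ?_⟩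
    have hγ : γ * ModularGroup.T ^ (-γ 1 1) = ModularGroup.T ^ (γ 0 0) * ModularGroup.S := by
      ext i j
      fin_cases i <;> fin_cases j <;>
        simp [-_root_.zpow_neg, mul_apply_eq, ModularGroup.coe_T_zpow, ModularGroup.coe_S, h]
      rw [h] at hdet
      push_cast at hdet
      linarith
    rw [hγ, nuEta_T_zpow_mul, nuEta_S, etaMultiplier, etaExponent]
    simp [mul_apply_eq, ModularGroup.coe_T_zpow, ModularGroup.coe_S, ← e24_add, sub_eq_add_neg]
  · have hcd : ¬ (c : ℤ) ∣ γ 1 1 := by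
      intro hdvd
      have : (c : ℤ) ∣ 1 := by
        rw [← hdet, h]
        exact dvd_sub (hdvd.mul_left _) (dvd_mul_left _ _)
      have := Int.le_of_dvd one_pos this
      omega
    obtain ⟨n, hn, hlt⟩ := exists_odd_natAbs_lt hc hc1 hcd
    refine ⟨n, ?_⟩
    have h10 := hT10 n
    have h11 := hT11 n
    generalize γ * ModularGroup.T ^ n = δ at h10 h11 ⊢
    rw [← h11] at hn hlt
    have hodd : Odd (δ 1 1).natAbs := Int.natAbs_odd.2 hn
    rcases le_or_gt 0 (δ 1 1) with hpos | hneg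
    · have hd : δ 1 1 = ((δ 1 1).natAbs : ℕ) := by omega
      have := ih _ hlt hodd (δ * ModularGroup.S) (by
        simp [mul_apply_eq, ModularGroup.coe_S, abs_of_nonneg hpos])
      rw [nuEta_mul_S (by omega) (by have := hodd.pos; omega),
        etaMultiplier_mul_S h10 hd hc hodd] at this
      exact mul_right_cancel₀ (e24_ne_zero _) this
    · have hd : δ 1 1 = -((δ 1 1).natAbs : ℕ) := by omega
      have := ih _ hlt hodd (δ * ModularGroup.S⁻¹) (by
        simp [mul_apply_eq, abs_of_neg hneg])
      rw [nuEta_mul_S_inv (by omega), etaMultiplier_mul_S_inv h10 hd hc hodd] at this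
      exact mul_right_cancel₀ (e24_ne_zero _) this

/-- The point `p z` of the upper half-plane. -/
def natMul (p : ℕ) [NeZero p] (z : ℍ) : ℍ :=
  ⟨p * z, by
    have := Nat.pos_of_ne_zero (NeZero.ne p)
    have := z.2
    rw [← Complex.ofReal_natCast, Complex.im_ofReal_mul]
    positivity⟩

lemma coe_natMul (p : ℕ) [NeZero p] (z : ℍ) : (natMul p z : ℂ) = p * z := rfl

/-- The second matrix is the conjugate of the first by `diag(p, 1)`. -/
structure IsDiagConj (p : ℕ) (γ γ' : SL2Z) : Prop where
  h00 : γ' 0 0 = γ 0 0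
  h01 : γ' 0 1 = p * γ 0 1
  h10 : γ 1 0 = p * γ' 1 0
  h11 : γ' 1 1 = γ 1 1

namespace IsDiagConj

variable {p : ℕ} {γ γ' δ δ' : SL2Z}

lemma mul (h : IsDiagConj p γ γ') (h' : IsDiagConj p δ δ') : IsDiagConj p (γ * δ) (γ' * δ') where
  h00 := by rw [mul_apply_eq, mul_apply_eq, h.h00, h.h01, h'.h00, h'.h10]; ring
  h01 := by rw [mul_apply_eq, mul_apply_eq, h.h00, h.h01, h'.h01, h'.h11]; ring
  h10 := by rw [mul_apply_eq, mul_apply_eq, h.h10, h.h11, h'.h00, h'.h10]; ring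
  h11 := by rw [mul_apply_eq, mul_apply_eq, h.h10, h.h11, h'.h01, h'.h11]; ring

lemma exists_of_dvd {γ : SL2Z} (h : (p : ℤ) ∣ γ 1 0) : ∃ γ', IsDiagConj p γ γ' := by
  obtain ⟨c, hc⟩ := h
  refine ⟨⟨!![γ 0 0, p * γ 0 1; c, γ 1 1], ?_⟩, ⟨rfl, rfl, hc, rfl⟩⟩
  rw [Matrix.det_fin_two_of]
  linear_combination det_eq_one γ + γ 0 1 * hc

lemma sldenom_natMul [NeZero p] (h : IsDiagConj p γ γ') (z : ℍ) :
    sldenom γ' (natMul p z) = sldenom γ z := by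
  rw [sldenom, sldenom, h.h10, h.h11, coe_natMul]
  push_cast
  ring

lemma natMul_smul [NeZero p] (h : IsDiagConj p γ γ') (z : ℍ) :
    natMul p (γ • z) = γ' • natMul p z := by
  ext
  rw [coe_natMul, coe_smul_eq_div, coe_smul_eq_div, h.sldenom_natMul, h.h00, h.h01, coe_natMul]
  push_cast
  ring

lemma etaQuotient_smul [NeZero p] (hp : Odd p) (h : IsDiagConj p γ γ') (z : ℍ) :
    dedekindEta (natMul p (γ • z)) / dedekindEta (γ • z) ^ p * sldenom γ z ^ (p / 2) =
      nuEta γ' / nuEta γ ^ p * (dedekindEta (natMul p z) / dedekindEta z ^ p) := by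
  rw [h.natMul_smul, dedekindEta_smul, dedekindEta_smul, h.sldenom_natMul]
  have h1 : (sldenom γ z ^ ((1 : ℂ) / 2)) ^ p =
      sldenom γ z ^ ((1 : ℂ) / 2) * sldenom γ z ^ (p / 2) := by
    conv_lhs => rw [← Nat.two_mul_div_two_add_one_of_odd hp]
    rw [pow_succ', pow_mul, cpow_half_sq]
  rw [mul_pow, mul_pow, h1]
  have := cpow_half_ne_zero (sldenom_ne_zero γ z)
  have := sldenom_ne_zero γ z
  have := nuEta_ne_zero γ
  have := dedekindEta_ne_zero z
  field_simp

lemma nuEta_mul_div [NeZero p] (hp : Odd p) (h : IsDiagConj p γ γ') (h' : IsDiagConj p δ δ') :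
    nuEta (γ' * δ') / nuEta (γ * δ) ^ p = nuEta γ' / nuEta γ ^ p * (nuEta δ' / nuEta δ ^ p) := by
  have hne : dedekindEta (natMul p UpperHalfPlane.I) / dedekindEta UpperHalfPlane.I ^ p ≠ 0 :=
    div_ne_zero (dedekindEta_ne_zero _) (pow_ne_zero _ (dedekindEta_ne_zero _))
  apply mul_right_cancel₀ hne
  rw [← (h.mul h').etaQuotient_smul hp, mul_assoc, ← h'.etaQuotient_smul hp, ← mul_assoc,
    ← h.etaQuotient_smul hp, mul_smul, sldenom_mul, mul_pow, mul_assoc]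

end IsDiagConj

lemma jacobiSym_pow_of_odd {n : ℕ} (hn : Odd n) (a : ℤ) (b : ℕ) :
    jacobiSym a b ^ n = jacobiSym a b := by
  rcases jacobiSym.trichotomy a b with h | h | h <;> rw [h]
  · exact zero_pow hn.pos.ne'
  · exact one_pow n
  · exact hn.neg_one_pow

lemma jacobiSym_sq_of_dvd (γ : SL2Z) {n : ℕ} (hn : (n : ℤ) ∣ γ 1 0) :
    jacobiSym (γ 1 1) n ^ 2 = 1 := by
  apply jacobiSym.sq_one
  rw [← Int.isCoprime_iff_gcd_eq_one]
  obtain ⟨c, hc⟩ := hn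
  refine ⟨γ 0 0, -(γ 0 1 * c), ?_⟩
  linear_combination det_eq_one γ + γ 0 1 * hc

lemma natCast_sq_sub_one_dvd {p : ℕ} (hp : p.Prime) (hp5 : 5 ≤ p) : (24 : ℤ) ∣ p ^ 2 - 1 := by
  have h2 : ¬ 2 ∣ p := fun h => by have := (Nat.prime_dvd_prime_iff_eq Nat.prime_two hp).1 h; omega
  have h3 : ¬ 3 ∣ p := fun h => by
    have := (Nat.prime_dvd_prime_iff_eq Nat.prime_three hp).1 h; omega
  have h8 : (8 : ℤ) ∣ (p : ℤ) ^ 2 - 1 := Int.eight_dvd_sq_sub_one_of_odd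
    ⟨p / 2, by omega⟩
  have h3 : (3 : ℤ) ∣ (p : ℤ) ^ 2 - 1 := by
    have : (p : ℤ) % 3 = 1 ∨ (p : ℤ) % 3 = 2 := by omega
    apply Int.dvd_of_emod_eq_zero
    rcases this with h | h <;> simp [Int.sub_emod, pow_two, Int.mul_emod, h]
  simpa using IsCoprime.mul_dvd (by norm_num : IsCoprime (8 : ℤ) 3) h8 h3

lemma IsDiagConj.nuEta_div_of_odd {p : ℕ} (hp : p.Prime) (hp5 : 5 ≤ p) {γ γ' : SL2Z}
    (h : IsDiagConj p γ γ') (hodd : Odd (γ 1 0)) (hpos : 0 < γ 1 0) :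
    nuEta γ' / nuEta γ ^ p = jacobiSym (γ 1 1) p := by
  have hp2 : Odd p := hp.odd_of_ne_two (by omega)
  have hpz : (0 : ℤ) < p := by omega
  rw [div_eq_iff (pow_ne_zero _ (nuEta_ne_zero γ))]
  have hc' : 0 < γ' 1 0 := by
    have := h.h10 ▸ hpos
    exact pos_of_mul_pos_right this hpz.le
  have hodd' : Odd (γ' 1 0) := (Int.odd_mul.1 (h.h10 ▸ hodd)).2
  obtain ⟨c, hc⟩ := Int.eq_ofNat_of_zero_le hc'.le
  have hcodd : Odd c := by rw [hc] at hodd'; exact_mod_cast hodd'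
  have h10 : γ 1 0 = (p * c : ℕ) := by rw [h.h10, hc]; push_cast; ring
  have hcodd2 : Odd (p * c) := hp2.mul hcodd
  rw [nuEta_eq_etaMultiplier hcodd γ' hc, nuEta_eq_etaMultiplier hcodd2 γ h10, etaMultiplier,
    etaMultiplier, etaExponent, etaExponent, hc, h10, h.h11, h.h00, h.h01, Int.natAbs_natCast,
    Int.natAbs_natCast, mul_pow, e24_pow]
  have : NeZero p := ⟨hp.ne_zero⟩
  have : NeZero c := ⟨hcodd.pos.ne'⟩
  have hJ : jacobiSym (γ 1 1) c =
      jacobiSym (γ 1 1) p * jacobiSym (γ 1 1) (p * c) ^ p := by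
    rw [jacobiSym_pow_of_odd hp2, jacobiSym.mul_right, ← mul_assoc, ← pow_two,
      jacobiSym_sq_of_dvd γ (h10 ▸ by push_cast; exact dvd_mul_right _ _), one_mul]
  rw [hJ, ← mul_assoc]
  push_cast
  congr 1
  apply e24_eq_of_dvd
  convert! (natCast_sq_sub_one_dvd hp hp5).mul_right
    (-((γ 0 0 + γ 1 1) * c - p * γ 0 1 * γ 1 1 * c ^ 2 - 3 * c)) using 1
  ring

/-- The lower unipotent matrix with entry `m`. -/
def lowerUnipotent (m : ℤ) : SL2Z := ⟨!![1, 0; m, 1], by simp⟩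

lemma lowerUnipotent_add (m n : ℤ) :
    lowerUnipotent (m + n) = lowerUnipotent m * lowerUnipotent n := by
  ext i j
  rw [mul_apply_eq]
  fin_cases i <;> fin_cases j <;> simp [lowerUnipotent]

lemma isDiagConj_lowerUnipotent (p : ℕ) (m : ℤ) :
    IsDiagConj p (lowerUnipotent (p * m)) (lowerUnipotent m) where
  h00 := rfl
  h01 := by simp [lowerUnipotent]
  h10 := rfl
  h11 := rfl

lemma nuEta_lowerUnipotent_div {p : ℕ} (hp : p.Prime) (hp5 : 5 ≤ p) (m : ℤ) :
    nuEta (lowerUnipotent m) / nuEta (lowerUnipotent (p * m)) ^ p = 1 := by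
  have hp2 : Odd p := hp.odd_of_ne_two (by omega)
  have : NeZero p := ⟨hp.ne_zero⟩
  have h1 : nuEta (lowerUnipotent 1) / nuEta (lowerUnipotent (p * 1)) ^ p = 1 := by
    rw [(isDiagConj_lowerUnipotent p 1).nuEta_div_of_odd hp hp5]
    · simp [lowerUnipotent]
    · simpa [lowerUnipotent] using hp2
    · simp [lowerUnipotent, hp.pos]
  have hadd (n : ℤ) : nuEta (lowerUnipotent (n + 1)) / nuEta (lowerUnipotent (p * (n + 1))) ^ p =
      nuEta (lowerUnipotent n) / nuEta (lowerUnipotent (p * n)) ^ p := by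
    rw [mul_add, lowerUnipotent_add, lowerUnipotent_add,
      (isDiagConj_lowerUnipotent p n).nuEta_mul_div hp2 (isDiagConj_lowerUnipotent p 1), h1,
      mul_one]
  induction m using Int.induction_on with
  | zero => rw [← hadd 0, zero_add, h1]
  | succ n ih => rw [hadd, ih]
  | pred n ih => rw [← hadd, sub_add_cancel, ih]

lemma IsDiagConj.nuEta_eq {p : ℕ} (hp : p.Prime) (hp5 : 5 ≤ p) {γ γ' : SL2Z}
    (h : IsDiagConj p γ γ') :
    nuEta γ' = jacobiSym (γ 1 1) p * nuEta γ ^ p := by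
  have hp2 : Odd p := hp.odd_of_ne_two (by omega)
  have : NeZero p := ⟨hp.ne_zero⟩
  rw [← div_eq_iff (pow_ne_zero _ (nuEta_ne_zero γ))]
  have hdet := det_eq_one γ
  have hd : γ 1 1 ≠ 0 := by
    intro hd
    rw [hd, h.h10] at hdet
    have : (p : ℤ) ∣ 1 := ⟨-(γ 0 1 * γ' 1 0), by linear_combination -hdet⟩
    have := Int.le_of_dvd one_pos this
    omega
  obtain ⟨m, hodd, hpos⟩ : ∃ m : ℤ, Odd (γ 1 0 + γ 1 1 * (p * m)) ∧
      0 < γ 1 0 + γ 1 1 * (p * m) := by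
    have key (t : ℤ) (ht : |γ 1 0| < t) : 0 < γ 1 0 + γ 1 1 * (p * (γ 1 1 * t)) := by
      have h1 : t ≤ γ 1 1 * (p * (γ 1 1 * t)) := by
        have : 0 < γ 1 1 ^ 2 := by positivity
        have h2 : 1 ≤ γ 1 1 ^ 2 * p := by nlinarith [hp.pos]
        have h3 : 0 ≤ t := (abs_nonneg _).trans ht.le
        nlinarith
      have := neg_abs_le (γ 1 0)
      linarith
    rcases Int.even_or_odd (γ 1 0) with he | ho
    · have hdo : Odd (γ 1 1) := by
        by_contra hne
        rw [Int.not_odd_iff_even] at hne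
        have : Even (1 : ℤ) := by
          rw [← hdet]
          exact (hne.mul_left _).sub (he.mul_left _)
        simp at this
      refine ⟨γ 1 1 * (2 * |γ 1 0| + 1), he.add_odd ?_, key _ ?_⟩
      · exact hdo.mul ((by exact_mod_cast hp2 : Odd (p : ℤ)).mul (hdo.mul ⟨_, rfl⟩))
      · linarith [abs_nonneg (γ 1 0)]
    · refine ⟨γ 1 1 * (2 * (|γ 1 0| + 1)), ho.add_even ?_, key _ ?_⟩
      · exact Even.mul_left (Even.mul_left (Even.mul_left ⟨_, two_mul _⟩ _) _) _
      · linarith [abs_nonneg (γ 1 0)]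
  have h10 : (γ * lowerUnipotent (p * m)) 1 0 = γ 1 0 + γ 1 1 * (p * m) := by
    rw [mul_apply_eq]
    simp [lowerUnipotent]
  have h11 : (γ * lowerUnipotent (p * m)) 1 1 = γ 1 1 := by
    rw [mul_apply_eq]
    simp [lowerUnipotent]
  have := (h.mul (isDiagConj_lowerUnipotent p m)).nuEta_div_of_odd hp hp5 (h10 ▸ hodd) (h10 ▸ hpos)
  rwa [h.nuEta_mul_div hp2 (isDiagConj_lowerUnipotent p m), nuEta_lowerUnipotent_div hp hp5,
    mul_one, h11] at this

lemma tendsto_atImInfty_of_im_eq_mul {w : ℍ → ℍ} {t : ℝ} (ht : 0 < t)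
    (hw : ∀ z, (w z).im = t * z.im) : Filter.Tendsto w atImInfty atImInfty := by
  rw [atImInfty, Filter.tendsto_comap_iff, show UpperHalfPlane.im ∘ w = fun z => t * z.im from
    funext hw]
  exact Filter.tendsto_comap.const_mul_atTop ht

lemma natMul_im (p : ℕ) [NeZero p] (z : ℍ) : (natMul p z).im = p * z.im := by
  rw [← UpperHalfPlane.coe_im, coe_natMul, ← Complex.ofReal_natCast, Complex.im_ofReal_mul,
    UpperHalfPlane.coe_im]

/-- The point `(z + b) / p` of the upper half-plane. -/
def addDiv (p : ℕ) [NeZero p] (b : ℤ) (z : ℍ) : ℍ :=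
  ⟨(z + b) / p, by
    have := Nat.pos_of_ne_zero (NeZero.ne p)
    have := z.2
    rw [Complex.div_natCast_im, Complex.add_im, Complex.intCast_im, add_zero]
    positivity⟩

lemma coe_addDiv (p : ℕ) [NeZero p] (b : ℤ) (z : ℍ) : (addDiv p b z : ℂ) = (z + b) / p := rfl

lemma addDiv_im (p : ℕ) [NeZero p] (b : ℤ) (z : ℍ) : (addDiv p b z).im = (p : ℝ)⁻¹ * z.im := by
  rw [← UpperHalfPlane.coe_im, coe_addDiv, Complex.div_natCast_im, Complex.add_im,
    Complex.intCast_im, add_zero, UpperHalfPlane.coe_im, inv_mul_eq_div]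

lemma isBoundedAtImInfty_natMul {p : ℕ} [NeZero p] (hp : p.Prime) {s : ℂ} {f : ℍ → ℂ}
    (hf : ∀ γ : SL2Z, IsBoundedAtImInfty fun z => sldenom γ z ^ s * f (γ • z)) (γ : SL2Z) :
    IsBoundedAtImInfty fun z => sldenom γ z ^ s * f (natMul p (γ • z)) := by
  have hp0 : (0 : ℝ) < p := by exact_mod_cast hp.pos
  by_cases hc : (p : ℤ) ∣ γ 1 0
  · obtain ⟨γ', h⟩ := IsDiagConj.exists_of_dvd hc
    have hb := (hf γ').comp_tendsto (tendsto_atImInfty_of_im_eq_mul hp0 (natMul_im p))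
    refine hb.congr_left fun z => ?_
    simp only [Function.comp_apply]
    rw [h.sldenom_natMul, h.natMul_smul]
  · have hco : IsCoprime (p : ℤ) (γ 1 0) :=
      (Nat.prime_iff_prime_int.1 hp).coprime_iff_not_dvd.2 hc
    obtain ⟨u, v, huv⟩ := hco
    set B := v * γ 1 1 with hB
    let δ : SL2Z := ⟨!![p * γ 0 0, γ 0 1 - γ 0 0 * B; γ 1 0, u * γ 1 1], by
      rw [Matrix.det_fin_two_of]
      linear_combination det_eq_one γ + γ 0 0 * γ 1 1 * huv⟩
    have hp0' : (p : ℂ) ≠ 0 := by exact_mod_cast hp.ne_zero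
    have hd : (u * p + v * γ 1 0 : ℂ) = 1 := by exact_mod_cast huv
    have hden (z : ℍ) : sldenom γ z = (p : ℝ) * sldenom δ (addDiv p B z) := by
      simp only [sldenom, δ, coe_addDiv, hB]
      simp
      field_simp
      linear_combination (-(γ 1 1 : ℂ)) * hd
    have hsmul (z : ℍ) : natMul p (γ • z) = δ • addDiv p B z := by
      ext
      have h1 := sldenom_ne_zero γ z
      have h2 := hden z ▸ h1
      rw [coe_natMul, coe_smul_eq_div, coe_smul_eq_div, hden, mul_div_assoc']
      rw [div_eq_div_iff h2 (sldenom_ne_zero _ _)]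
      simp only [δ, coe_addDiv, hB]
      simp
      field_simp
      ring
    have hb := (hf δ).comp_tendsto
      (tendsto_atImInfty_of_im_eq_mul (inv_pos.2 hp0) (addDiv_im p B))
    refine (hb.const_mul_left ((p : ℝ) ^ s : ℂ)).congr_left fun z => ?_
    simp only [Function.comp_apply]
    rw [hden, hsmul, ← mul_assoc]
    congr 1
    refine (mul_cpow_of_arg (by exact_mod_cast hp.ne_zero) (sldenom_ne_zero _ _) ?_ s).symm
    rw [Complex.arg_ofReal_of_nonneg hp0.le, zero_add]
    exact Complex.arg_mem_Ioc _

lemma mdifferentiable_natMul (p : ℕ) [NeZero p] {f : ℍ → ℂ} (hf : MDifferentiable 𝓘(ℂ) 𝓘(ℂ) f) :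
    MDifferentiable 𝓘(ℂ) 𝓘(ℂ) fun z => f (natMul p z) := by
  rw [UpperHalfPlane.mdifferentiable_iff] at hf ⊢
  have h (z : ℂ) (hz : z ∈ {z : ℂ | 0 < z.im}) : (p : ℂ) * z ∈ {z : ℂ | 0 < z.im} :=
    (natMul p ⟨z, hz⟩).2
  refine (hf.comp (differentiableOn_id.const_mul (p : ℂ)) h).congr fun z hz => ?_
  simp only [Function.comp_apply]
  rw [UpperHalfPlane.ofComplex_apply_of_im_pos hz, UpperHalfPlane.ofComplex_apply_of_im_pos (h z hz)]
  rfl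

lemma q24_natMul (p n : ℕ) [NeZero p] (z : ℍ) : q24 n (natMul p z) = q24 (p * n) z := by
  rw [q24, q24, coe_natMul]
  push_cast
  ring_nf

/-- `V_p` maps `M_k(N, χ ν_η^r)` into `M_k(Np, χ χ_p ν_η^{pr})`. -/
theorem stmt6 (r : ℕ) (hr0 : 0 < r) (hr6 : Nat.gcd r 6 = 1)
    (N : ℕ) (hN : 0 < N) (χ : DirichletCharacter ℂ N)
    (p : ℕ) (hp : p.Prime) (hp5 : 5 ≤ p)
    (k : ℝ) (hk : ∃ j : ℤ, 2 * k = (j : ℝ))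
    (f : ℍ → ℂ) (a : ℕ → ℂ)
    (hf : IsModForm N k (fun γ => χ ((γ 1 1 : ℤ) : ZMod N) * nuEta γ ^ r) f)
    (hexp : ∀ z : ℍ, f z = ∑' n : ℕ, a n * q24 n z) :
    IsModForm (N * p) k
      (fun γ => χ ((γ 1 1 : ℤ) : ZMod N) * ((jacobiSym (γ 1 1) p : ℤ) : ℂ) * nuEta γ ^ (p * r))
      (fun z => ∑' n : ℕ, a n * q24 (p * n) z) := by
  have : NeZero p := ⟨hp.ne_zero⟩
  have hg : (fun z => ∑' n : ℕ, a n * q24 (p * n) z) = fun z => f (natMul p z) := by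
    funext z
    simp only [hexp, q24_natMul]
  rw [hg]
  obtain ⟨hdiff, htrans, hbdd⟩ := hf
  refine ⟨mdifferentiable_natMul p hdiff, fun γ hγ z => ?_, isBoundedAtImInfty_natMul hp hbdd⟩
  have hdvd : ((N * p : ℕ) : ℤ) ∣ γ 1 0 := by
    rwa [CongruenceSubgroup.Gamma0_mem, ZMod.intCast_zmod_eq_zero_iff_dvd] at hγ
  push_cast at hdvd
  obtain ⟨γ', h⟩ := IsDiagConj.exists_of_dvd ((dvd_mul_left _ _).trans hdvd)
  have hγ' : γ' ∈ Gamma0 N := by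
    rw [CongruenceSubgroup.Gamma0_mem, ZMod.intCast_zmod_eq_zero_iff_dvd]
    rw [h.h10, mul_comm] at hdvd
    exact Int.dvd_of_mul_dvd_mul_left (by exact_mod_cast hp.ne_zero) hdvd
  have hr : Odd r := by
    rw [← Nat.not_even_iff_odd]
    intro he
    have := Nat.dvd_gcd he.two_dvd (by norm_num : 2 ∣ 6)
    omega
  simp only
  rw [h.natMul_smul, htrans γ' hγ', h.sldenom_natMul]
  simp only
  rw [h.h11, h.nuEta_eq hp hp5, mul_pow,
    ← Int.cast_pow, jacobiSym_pow_of_odd hr, ← pow_mul]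
  ring
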